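/- arXiv:2010.00646 — 3 statements merged into one kernel-verified Lean document; each statement's English description precedes it below -/
import Mathlib

section
/- Let A be an essentially small hereditary abelian category over a finite field, and let C_1(A) be the abelian category of 1-periodic complexes (pairs (X,d) with d: X → X, d² = 0 as differential, i.e., d∘d = 0). For any acyclic 1-periodic complex K and any p ≥ 2, Ext^p_{C_1(A)}(K, M) = 0 = Ext^p_{C_1(A)}(M, K) for all objects M of C_1(A). -/
open CategoryTheory

universe w w' v u

/-- The category `C₁(A)` of 1-periodic complexes in `A`: pairs `(X, d)` with `d : X → X`
and `d ∘ d = 0`, realized as homological complexes indexed by `ZMod 1`. -/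
abbrev OnePeriodic (A : Type u) [Category.{v} A] [Limits.HasZeroMorphisms A] :=
  HomologicalComplex A (ComplexShape.up (ZMod 1))

section Efface
open HomologicalComplex Limits Abelian DerivedCategory Category
variable {C : Type u} [Category.{v} C] [Abelian C]

lemma onePer_epi_aux
    {P : C} {K : CochainComplex C ℤ} {i : ℤ}
    (π : K ⟶ (single C (ComplexShape.up ℤ) i).obj P) [K.IsStrictlyLE i] [QuasiIsoAt π i] :
    ∃ (α : K.X i ⟶ P), Epi α ∧ ∃ (t : (single C (ComplexShape.up ℤ) i).obj (K.X i) ⟶ K),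
      t ≫ π = (single C (ComplexShape.up ℤ) i).map α := by
  let e := K.iCyclesIso i (i + 1) (by simp)
    ((K.isZero_of_isStrictlyLE i (i + 1) (by simp)).eq_of_tgt _ _)
  let α := e.inv ≫ K.homologyπ i ≫ homologyMap π i ≫ (singleObjHomologySelfIso _ _ _).hom
  have : π.f i = α ≫ (singleObjXSelf (ComplexShape.up ℤ) i P).inv := by
    rw [← cancel_epi e.hom]
    dsimp [α, e]
    rw [assoc, assoc, assoc, Iso.hom_inv_id_assoc, iCyclesIso_hom,
      homologyπ_naturality_assoc]
    rw [homologyπ_singleObjHomologySelfIso_hom_assoc,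
      ← singleObjCyclesSelfIso_inv_iCycles, Iso.hom_inv_id_assoc, ← cyclesMap_i]
  refine ⟨α, ?_, mkHomFromSingle (𝟙 _) (by
      rintro _ rfl
      apply (K.isZero_of_isStrictlyLE i (i + 1) (by simp)).eq_of_tgt), ?_⟩
  · dsimp only [α]
    infer_instance
  · apply HomologicalComplex.from_single_hom_ext
    rw [comp_f, mkHomFromSingle_f, assoc, this]
    simp [single_map_f_self]

lemma onePer_efface_epi [HasExt.{w} C] {X Y : C} {n : ℕ} (e : Ext X Y (n + 1)) :
    ∃ (E : C) (p : E ⟶ X), Epi p ∧ (Ext.mk₀ p).comp e (zero_add _) = 0 := by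
  let := HasDerivedCategory.standard C
  let φ : Q.obj ((CochainComplex.singleFunctor C 0).obj X) ⟶
    Q.obj ((CochainComplex.singleFunctor C (-(n+1))).obj Y) :=
      e.hom ≫ ((singleFunctors C).shiftIso (n + 1) (-(n + 1)) 0 (by lia)).hom.app Y
  obtain ⟨K, _, π, h, g, hg⟩ := right_fac_of_isStrictlyLE φ 0
  have h' := h
  rw [isIso_Q_map_iff_quasiIso] at h'
  have h'' : QuasiIsoAt π 0 := inferInstance
  let π₀ : K ⟶ (single C (ComplexShape.up ℤ) 0).obj X := π
  have h0 : QuasiIsoAt π₀ 0 := h''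
  obtain ⟨α, hα, t, ht⟩ := onePer_epi_aux π₀
  refine ⟨_, α, hα, ?_⟩
  apply Ext.homEquiv.injective
  simp only [← cancel_mono (((singleFunctors C).shiftIso (n + 1) (-(n + 1)) 0
    (by lia)).hom.app _), Ext.zero_hom, Limits.zero_comp]
  have h₂ : t ≫ g = 0 := by
    apply HomologicalComplex.from_single_hom_ext
    apply (((CochainComplex.singleFunctor C (-(n+1))).obj Y).isZero_of_isStrictlyLE (-(n+1)) 0 (by lia)).eq_of_tgt
  have h₃ : Q.map ((CochainComplex.singleFunctor C 0).map α) ≫ φ = 0 := by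
    let t' : (CochainComplex.singleFunctor C 0).obj (K.X 0) ⟶ K := t
    have ht' : t' ≫ π = (CochainComplex.singleFunctor C 0).map α := ht
    have h₂' : t' ≫ g = 0 := h₂
    rw [hg, ← ht', Q.map_comp, assoc, IsIso.hom_inv_id_assoc, ← Q.map_comp, h₂', Q.map_zero]
  have hc := (Ext.singleFunctor_map_comp_hom α e).symm
  refine (congrArg (· ≫ ((singleFunctors C).shiftIso (n + 1) (-(n + 1)) 0
    (by lia)).hom.app Y) hc).trans ?_
  exact (assoc _ _ _).trans h₃

lemma onePer_efface_mono [HasExt.{w} C] {X Y : C} {n : ℕ} (e : Ext X Y (n + 1)) :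
    ∃ (E : C) (i : Y ⟶ E), Mono i ∧ e.comp (Ext.mk₀ i) (add_zero _) = 0 := by
  induction n generalizing X with
  | zero =>
    obtain ⟨E, p, hp, h⟩ := onePer_efface_epi e
    let S : ShortComplex C := ShortComplex.mk (kernel.ι p) p (by simp)
    have hS : S.ShortExact :=
      { exact := ShortComplex.exact_of_f_is_kernel _ (kernelIsKernel p) }
    obtain ⟨x, rfl⟩ := Ext.contravariant_sequence_exact₃ hS Y e h (n₀ := 0) (by lia)
    obtain ⟨f, rfl⟩ := (Ext.mk₀_bijective _ _).2 x
    refine ⟨_, pushout.inr S.f f, inferInstance, ?_⟩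
    rw [Ext.comp_assoc_of_third_deg_zero, Ext.mk₀_comp_mk₀, ← pushout.condition,
      ← Ext.mk₀_comp_mk₀, hS.extClass_comp_assoc]
  | succ n ih =>
    obtain ⟨E, p, hp, h⟩ := onePer_efface_epi e
    let S : ShortComplex C := ShortComplex.mk (kernel.ι p) p (by simp)
    have hS : S.ShortExact :=
      { exact := ShortComplex.exact_of_f_is_kernel _ (kernelIsKernel p) }
    obtain ⟨x, rfl⟩ := Ext.contravariant_sequence_exact₃ hS Y e h (n₀ := n+1) (by lia)
    obtain ⟨E, i, hi, h⟩ := ih x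
    refine ⟨E, i, hi, ?_⟩
    rw [Ext.comp_assoc_of_third_deg_zero, h, Ext.comp_zero]
end Efface

section OneP
open HomologicalComplex Limits Abelian Category
variable {A : Type u} [Category.{v} A] [Abelian A]

lemma onePer_rel (i j : ZMod 1) : (ComplexShape.up (ZMod 1)).Rel i j := Subsingleton.elim _ _

/-- A family over `ZMod 1` from its value at `0`. -/
def onePerFam {P : ZMod 1 → Sort*} (h : P 0) (i : ZMod 1) : P i :=
  (Subsingleton.elim 0 i : (0 : ZMod 1) = i) ▸ h

lemma onePer_forall {P : ZMod 1 → Prop} (h : P 0) (i : ZMod 1) : P i := onePerFam h i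

lemma onePerFam_zero {P : ZMod 1 → Sort*} (h : P 0) : onePerFam h 0 = h := rfl

/-- The free contractible complex. -/
noncomputable def onePerFree (Y : A) : OnePeriodic A where
  X _ := Y ⊞ Y
  d _ _ := biprod.fst ≫ biprod.inr
  shape i j h := (h (onePer_rel i j)).elim
  d_comp_d' _ _ _ _ _ := by simp

lemma onePer_exactAt_iff (K : OnePeriodic A) (i : ZMod 1) :
    K.ExactAt i ↔ (K.sc' i i i).Exact :=
  K.exactAt_iff' i i i (Subsingleton.elim _ _) (Subsingleton.elim _ _)

lemma onePer_biprod_aux {Y T : A} (x : T ⟶ Y ⊞ Y) (hx : x ≫ biprod.fst ≫ biprod.inr (X := Y) = 0) :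
    𝟙 T ≫ x = biprod.lift (x ≫ biprod.snd) (0 : T ⟶ Y) ≫ biprod.fst ≫ biprod.inr := by
  have h0 : x ≫ biprod.fst = 0 := by
    have := congrArg (· ≫ biprod.snd) hx
    simpa using this
  apply biprod.hom_ext <;> simp [h0]

lemma onePerFree_exact (Y : A) (i : ZMod 1) : (onePerFree Y).ExactAt i := by
  rw [onePer_exactAt_iff, ShortComplex.exact_iff_exact_up_to_refinements]
  intro T x hx
  exact ⟨T, 𝟙 T, inferInstance, _, onePer_biprod_aux x hx⟩

/-- The map from the free complex. -/
noncomputable def onePerFreeπ (E : OnePeriodic A) : onePerFree (E.X 0) ⟶ E where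
  f := onePerFam (P := fun i => (onePerFree (E.X 0)).X i ⟶ E.X i) (biprod.desc (𝟙 _) (E.d 0 0))
  comm' i j _ := by
    obtain rfl : 0 = i := Subsingleton.elim _ _
    obtain rfl : 0 = j := Subsingleton.elim _ _
    change biprod.desc (𝟙 _) (E.d 0 0) ≫ E.d 0 0 =
      (biprod.fst ≫ biprod.inr) ≫ biprod.desc (𝟙 _) (E.d 0 0)
    apply biprod.hom_ext' <;> simp

/-- The map to the free complex. -/
noncomputable def onePerFreeι (E : OnePeriodic A) : E ⟶ onePerFree (E.X 0) where
  f := onePerFam (P := fun i => E.X i ⟶ (onePerFree (E.X 0)).X i) (biprod.lift (E.d 0 0) (𝟙 _))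
  comm' i j _ := by
    obtain rfl : 0 = i := Subsingleton.elim _ _
    obtain rfl : 0 = j := Subsingleton.elim _ _
    change biprod.lift (E.d 0 0) (𝟙 _) ≫ (biprod.fst ≫ biprod.inr) =
      E.d 0 0 ≫ biprod.lift (E.d 0 0) (𝟙 _)
    apply biprod.hom_ext <;> simp

instance onePerFreeπ_epi (E : OnePeriodic A) : Epi (onePerFreeπ E) := by
  apply epi_of_epi_f
  apply onePer_forall
  have : (biprod.inl : E.X 0 ⟶ _) ≫ (onePerFreeπ E).f 0 = 𝟙 _ := by
    change biprod.inl ≫ biprod.desc (𝟙 _) (E.d 0 0) = _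
    simp
  have h2 : Epi ((biprod.inl : E.X 0 ⟶ _) ≫ (onePerFreeπ E).f 0) := by rw [this]; infer_instance
  exact epi_of_epi (biprod.inl : E.X 0 ⟶ _) _

instance onePerFreeι_mono (E : OnePeriodic A) : Mono (onePerFreeι E) := by
  apply mono_of_mono_f
  apply onePer_forall
  have : (onePerFreeι E).f 0 ≫ (biprod.snd : _ ⟶ E.X 0) = 𝟙 _ := by
    change biprod.lift (E.d 0 0) (𝟙 _) ≫ biprod.snd = _
    simp
  have h2 : Mono ((onePerFreeι E).f 0 ≫ (biprod.snd : _ ⟶ E.X 0)) := by rw [this]; infer_instance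
  exact mono_of_mono _ (biprod.snd : _ ⟶ E.X 0)

lemma onePer_exact₁ {S : ShortComplex (OnePeriodic A)} (hS : S.ShortExact)
    (h₂ : ∀ i, S.X₂.ExactAt i) (h₃ : ∀ i, S.X₃.ExactAt i) (i : ZMod 1) : S.X₁.ExactAt i := by
  rw [exactAt_iff_isZero_homology]
  exact (hS.homology_exact₁ i i (onePer_rel i i)).isZero_of_both_zeros
    ((h₃ i).isZero_homology.eq_of_src _ _) ((h₂ i).isZero_homology.eq_of_tgt _ _)

lemma onePer_exact₃ {S : ShortComplex (OnePeriodic A)} (hS : S.ShortExact)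
    (h₂ : ∀ i, S.X₂.ExactAt i) (h₁ : ∀ i, S.X₁.ExactAt i) (i : ZMod 1) : S.X₃.ExactAt i := by
  rw [exactAt_iff_isZero_homology]
  exact (hS.homology_exact₃ i i (onePer_rel i i)).isZero_of_both_zeros
    ((h₂ i).isZero_homology.eq_of_src _ _) ((h₁ i).isZero_homology.eq_of_tgt _ _)

lemma onePer_mono_opc (K : OnePeriodic A) (h : ∀ i, K.ExactAt i) :
    Mono (K.opcyclesToCycles 0 0) :=
  ((HomologySequence.composableArrows₃_exact K 0 0 (onePer_rel 0 0)).exact 0).mono_g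
    ((h 0).isZero_homology.eq_of_src _ _)

lemma onePer_epi_opc (K : OnePeriodic A) (h : ∀ i, K.ExactAt i) :
    Epi (K.opcyclesToCycles 0 0) :=
  ((HomologySequence.composableArrows₃_exact K 0 0 (onePer_rel 0 0)).exact 1).epi_f
    ((h 0).isZero_homology.eq_of_tgt _ _)

lemma onePer_opcycles_shortExact {S : ShortComplex (OnePeriodic A)} (hS : S.ShortExact)
    (h₁ : ∀ i, S.X₁.ExactAt i) :
    (S.map (opcyclesFunctor A _ 0)).ShortExact := by
  have := hS.epi_g
  have := hS.mono_f
  have := onePer_mono_opc _ h₁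
  have hm : Mono (opcyclesMap S.f 0 ≫ S.X₂.opcyclesToCycles 0 0) := by
    rw [opcyclesToCycles_naturality]; infer_instance
  exact
    { exact := opcycles_right_exact S hS.exact 0
      mono_f := mono_of_mono (opcyclesMap S.f 0) (S.X₂.opcyclesToCycles 0 0)
      epi_g := (inferInstance : Epi (opcyclesMap S.g 0)) }

lemma onePer_cycles_shortExact {S : ShortComplex (OnePeriodic A)} (hS : S.ShortExact)
    (h₃ : ∀ i, S.X₃.ExactAt i) :
    (S.map (cyclesFunctor A _ 0)).ShortExact := by
  have := hS.epi_g
  have := hS.mono_f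
  have := onePer_epi_opc _ h₃
  have hm : Epi (S.X₂.opcyclesToCycles 0 0 ≫ cyclesMap S.g 0) := by
    rw [← opcyclesToCycles_naturality]; infer_instance
  exact
    { exact := cycles_left_exact S hS.exact 0
      mono_f := (inferInstance : Mono (cyclesMap S.f 0))
      epi_g := epi_of_epi (S.X₂.opcyclesToCycles 0 0) (cyclesMap S.g 0) }

end OneP

section Sing
open HomologicalComplex Limits Abelian Category
variable {A : Type u} [Category.{v} A] [Abelian A] {ι : Type*} [DecidableEq ι] {c : ComplexShape ι}

/-- The canonical map to the complex of opcycles. -/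
noncomputable def onePerQ (K : HomologicalComplex A c) (j : ι) :
    K ⟶ (single A c j).obj (K.opcycles j) :=
  mkHomToSingle (K.pOpcycles j) (fun i _ => K.d_pOpcycles i j)

/-- The canonical map from the complex of cycles. -/
noncomputable def onePerI (K : HomologicalComplex A c) (j : ι) :
    (single A c j).obj (K.cycles j) ⟶ K :=
  mkHomFromSingle (K.iCycles j) (fun i _ => K.iCycles_d j i)

lemma onePerQ_naturality {K L : HomologicalComplex A c} (f : K ⟶ L) (j : ι) :
    f ≫ onePerQ L j = onePerQ K j ≫ (single A c j).map (opcyclesMap f j) := by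
  apply to_single_hom_ext
  simp [onePerQ, single_map_f_self]

lemma onePerI_naturality {K L : HomologicalComplex A c} (f : K ⟶ L) (j : ι) :
    onePerI K j ≫ f = (single A c j).map (cyclesMap f j) ≫ onePerI L j := by
  apply from_single_hom_ext
  simp [onePerI, single_map_f_self]

lemma onePerQ_fac {K : HomologicalComplex A c} {j : ι} {N : A} (f : K ⟶ (single A c j).obj N) :
    ∃ g : K.opcycles j ⟶ N, f = onePerQ K j ≫ (single A c j).map g := by
  refine ⟨K.descOpcycles (f.f j ≫ (singleObjXSelf _ j N).hom) _ rfl ?_, ?_⟩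
  · rw [← f.comm_assoc]; simp
  · apply to_single_hom_ext
    simp [onePerQ, single_map_f_self]

lemma onePerI_fac {K : HomologicalComplex A c} {j : ι} {N : A} (f : (single A c j).obj N ⟶ K) :
    ∃ g : N ⟶ K.cycles j, f = (single A c j).map g ≫ onePerI K j := by
  refine ⟨K.liftCycles ((singleObjXSelf _ j N).inv ≫ f.f j) _ rfl ?_, ?_⟩
  · rw [assoc, f.comm]; simp
  · apply from_single_hom_ext
    simp [onePerI, single_map_f_self]

end Sing

section Filt
open HomologicalComplex Limits Category
variable {A : Type u} [Category.{v} A] [Abelian A]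

/-- Every 1-periodic complex is an extension of two complexes with zero differential. -/
lemma onePer_filtration (M : OnePeriodic A) (j : ZMod 1) :
    ∃ (S : ShortComplex (OnePeriodic A)) (_ : S.ShortExact) (N₁ N₃ : A)
      (_ : S.X₁ ≅ (single A (ComplexShape.up (ZMod 1)) j).obj N₁)
      (_ : S.X₃ ≅ (single A (ComplexShape.up (ZMod 1)) j).obj N₃), S.X₂ = M := by
  let g : M ⟶ (single A (ComplexShape.up (ZMod 1)) j).obj (Limits.image (M.d j j)) :=
    mkHomToSingle (Limits.factorThruImage (M.d j j)) (fun i _ => by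
      obtain rfl : i = j := Subsingleton.elim _ _
      rw [← cancel_mono (Limits.image.ι (M.d i i))]
      simp)
  have w0 : M.iCycles j ≫ Limits.factorThruImage (M.d j j) = 0 := by
    rw [← cancel_mono (Limits.image.ι (M.d j j))]
    simp
  have w : onePerI M j ≫ g = 0 := by
    apply from_single_hom_ext
    rw [comp_f, onePerI, mkHomFromSingle_f, mkHomToSingle_f, assoc, reassoc_of% w0]
    simp
  let T : ShortComplex A := ShortComplex.mk _ _ w0
  let U : ShortComplex A := ShortComplex.mk _ _ (M.iCycles_d j j)
  have hU : U.Exact := ShortComplex.exact_of_f_is_kernel _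
    (M.cyclesIsKernel j j (Subsingleton.elim _ _))
  let φ : T ⟶ U := { τ₁ := 𝟙 _, τ₂ := 𝟙 _, τ₃ := Limits.image.ι _ }
  have : Epi φ.τ₁ := inferInstanceAs (Epi (𝟙 _))
  have : IsIso φ.τ₂ := inferInstanceAs (IsIso (𝟙 _))
  have : Mono φ.τ₃ := inferInstanceAs (Mono (Limits.image.ι _))
  have hT : T.Exact := (ShortComplex.exact_iff_of_epi_of_isIso_of_mono φ).2 hU
  have hT' : T.ShortExact :=
    { exact := hT
      mono_f := inferInstanceAs (Mono (M.iCycles j))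
      epi_g := inferInstanceAs (Epi (Limits.factorThruImage _)) }
  let S : ShortComplex (OnePeriodic A) := ShortComplex.mk _ _ w
  refine ⟨S, ?_, _, _, Iso.refl _, Iso.refl _, rfl⟩
  apply shortExact_of_degreewise_shortExact
  intro i
  obtain rfl : i = j := Subsingleton.elim _ _
  have e : T ≅ S.map (HomologicalComplex.eval A (ComplexShape.up (ZMod 1)) i) :=
    ShortComplex.isoMk (singleObjXSelf (ComplexShape.up (ZMod 1)) i _).symm
      (Iso.refl _) (singleObjXSelf (ComplexShape.up (ZMod 1)) i _).symm
      (by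
        change (singleObjXSelf (ComplexShape.up (ZMod 1)) i _).inv ≫ (onePerI M i).f i =
          M.iCycles i ≫ 𝟙 _
        rw [onePerI, mkHomFromSingle_f, Iso.inv_hom_id_assoc, comp_id])
      (by
        change 𝟙 _ ≫ g.f i = Limits.factorThruImage (M.d i i) ≫
          (singleObjXSelf (ComplexShape.up (ZMod 1)) i _).inv
        rw [mkHomToSingle_f, id_comp])
  exact ShortComplex.shortExact_of_iso e hT'

end Filt

section Nat
open Limits Abelian Category
variable {C : Type*} [Category* C] [Abelian C] {D : Type*} [Category* D] [Abelian D]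
  [HasExt.{w} C] [HasExt.{w'} D]
  (F : C ⥤ D) [F.Additive] [PreservesFiniteLimits F] [PreservesFiniteColimits F]

lemma onePer_nat₁ {S : ShortComplex D} (hS : S.ShortExact) {T : ShortComplex C}
    (hT : T.ShortExact) (φ : S ⟶ T.map F) {N : C} {p q : ℕ} (β : Ext.{w} T.X₁ N p)
    (h : 1 + p = q) :
    (hS.extClass).comp ((Ext.mk₀ φ.τ₁).comp (β.mapExactFunctor F) (zero_add p)) h =
      (Ext.mk₀ φ.τ₃).comp ((hT.extClass.comp β h).mapExactFunctor F) (zero_add q) := by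
  rw [Ext.mapExactFunctor_comp, Ext.mapExactFunctor_extClass]
  have h1 := Ext.comp_assoc (a := q) (Ext.mk₀ φ.τ₃) (hT.map_of_exact F).extClass (β.mapExactFunctor F)
    (zero_add 1) h (by lia)
  have h2 := Ext.comp_assoc (a := q) hS.extClass (Ext.mk₀ φ.τ₁) (β.mapExactFunctor F)
    (add_zero 1) (zero_add p) (by lia)
  rw [ShortComplex.ShortExact.extClass_naturality hS (hT.map_of_exact F) φ] at h2
  exact h2.symm.trans h1

lemma onePer_nat₂ {S : ShortComplex D} (hS : S.ShortExact) {T : ShortComplex C}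
    (hT : T.ShortExact) (φ : T.map F ⟶ S) {N : C} {p q : ℕ} (β : Ext.{w} N T.X₃ p)
    (h : p + 1 = q) :
    ((β.mapExactFunctor F).comp (Ext.mk₀ φ.τ₃) (add_zero p)).comp hS.extClass h =
      ((β.comp hT.extClass h).mapExactFunctor F).comp (Ext.mk₀ φ.τ₁) (add_zero q) := by
  rw [Ext.mapExactFunctor_comp, Ext.mapExactFunctor_extClass]
  have h1 := Ext.comp_assoc (a := q) (β.mapExactFunctor F) (hT.map_of_exact F).extClass (Ext.mk₀ φ.τ₁)
    h (add_zero 1) (by lia)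
  have h2 := Ext.comp_assoc (a := q) (β.mapExactFunctor F) (Ext.mk₀ φ.τ₃) hS.extClass
    (add_zero p) (zero_add 1) (by lia)
  have h3 := ShortComplex.ShortExact.extClass_naturality (hT.map_of_exact F) hS φ
  exact h2.trans ((congrArg (fun y => (β.mapExactFunctor F).comp y h) h3.symm).trans h1.symm)
end Nat

section Main
open HomologicalComplex Limits Abelian Category
variable {A : Type u} [Category.{v} A] [Abelian A]  [HasExt.{w} A] [HasExt.{w'} (OnePeriodic A)]

lemma onePer_surj₁ (N : A) (p : ℕ) (K : OnePeriodic A) (hK : ∀ i, K.ExactAt i)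
    (α : Ext.{w'} K ((single A (ComplexShape.up (ZMod 1)) 0).obj N) p) :
    ∃ β : Ext.{w} (K.opcycles 0) N p,
      α = (Ext.mk₀ (onePerQ K 0)).comp (β.mapExactFunctor (single A (ComplexShape.up (ZMod 1)) 0))
        (zero_add p) := by
  induction p generalizing K with
  | zero =>
    obtain ⟨f, rfl⟩ := (Ext.mk₀_bijective _ _).2 α
    obtain ⟨g, rfl⟩ := onePerQ_fac f
    exact ⟨Ext.mk₀ g, by rw [Ext.mapExactFunctor_mk₀, Ext.mk₀_comp_mk₀]⟩
  | succ p ih =>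
    obtain ⟨E, π, _, h⟩ := onePer_efface_epi α
    let q := onePerFreeπ E ≫ π
    have hq : Epi q := epi_comp _ _
    let S : ShortComplex (OnePeriodic A) := ShortComplex.mk (kernel.ι q) q (by simp)
    have hS : S.ShortExact :=
      { exact := ShortComplex.exact_of_f_is_kernel _ (kernelIsKernel q) }
    have h₁ : ∀ i, S.X₁.ExactAt i := onePer_exact₁ hS (onePerFree_exact _) hK
    obtain ⟨x, rfl⟩ := Ext.contravariant_sequence_exact₃ hS _ α
      (by
        change (Ext.mk₀ (onePerFreeπ E ≫ π)).comp α _ = 0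
        rw [← Ext.mk₀_comp_mk₀_assoc, h, Ext.comp_zero]) (n₀ := p) (by lia)
    obtain ⟨β, rfl⟩ := ih S.X₁ h₁ x
    have hQ := onePer_opcycles_shortExact hS h₁
    refine ⟨hQ.extClass.comp β (by lia), ?_⟩
    exact onePer_nat₁ (single A (ComplexShape.up (ZMod 1)) 0) hS hQ
      { τ₁ := onePerQ _ 0
        τ₂ := onePerQ _ 0
        τ₃ := onePerQ _ 0
        comm₁₂ := (onePerQ_naturality _ 0).symm
        comm₂₃ := (onePerQ_naturality _ 0).symm } β (by lia)

lemma onePer_surj₂ (N : A) (p : ℕ) (K : OnePeriodic A) (hK : ∀ i, K.ExactAt i)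
    (α : Ext.{w'} ((single A (ComplexShape.up (ZMod 1)) 0).obj N) K p) :
    ∃ β : Ext.{w} N (K.cycles 0) p,
      α = (β.mapExactFunctor (single A (ComplexShape.up (ZMod 1)) 0)).comp (Ext.mk₀ (onePerI K 0))
        (add_zero p) := by
  induction p generalizing K with
  | zero =>
    obtain ⟨f, rfl⟩ := (Ext.mk₀_bijective _ _).2 α
    obtain ⟨g, rfl⟩ := onePerI_fac f
    exact ⟨Ext.mk₀ g, by rw [Ext.mapExactFunctor_mk₀, Ext.mk₀_comp_mk₀]⟩
  | succ p ih =>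
    obtain ⟨E, π, _, h⟩ := onePer_efface_mono α
    let q := π ≫ onePerFreeι E
    have hq : Mono q := mono_comp _ _
    let S : ShortComplex (OnePeriodic A) := ShortComplex.mk q (cokernel.π q) (by simp)
    have hS : S.ShortExact :=
      { exact := ShortComplex.exact_of_g_is_cokernel _ (cokernelIsCokernel q) }
    have h₃ : ∀ i, S.X₃.ExactAt i := onePer_exact₃ hS (onePerFree_exact _) hK
    obtain ⟨x, rfl⟩ := Ext.covariant_sequence_exact₁ _ hS α
      (by
        change α.comp (Ext.mk₀ (π ≫ onePerFreeι E)) _ = 0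
        rw [← Ext.mk₀_comp_mk₀, ← Ext.comp_assoc_of_third_deg_zero, h, Ext.zero_comp])
        (n₀ := p) (by lia)
    obtain ⟨β, rfl⟩ := ih S.X₃ h₃ x
    have hQ := onePer_cycles_shortExact hS h₃
    refine ⟨β.comp hQ.extClass (by lia), ?_⟩
    exact onePer_nat₂ (single A (ComplexShape.up (ZMod 1)) 0) hS hQ
      { τ₁ := onePerI _ 0
        τ₂ := onePerI _ 0
        τ₃ := onePerI _ 0
        comm₁₂ := onePerI_naturality _ 0
        comm₂₃ := onePerI_naturality _ 0 } β (by lia)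

end Main

/-- Let `A` be an essentially small hereditary abelian category, linear over a finite
field `𝕜`.  For any acyclic 1-periodic complex `K` over `A` and any `p ≥ 2`,
`Ext^p_{C₁(A)}(K, M) = 0 = Ext^p_{C₁(A)}(M, K)` for every 1-periodic complex `M`. -/
theorem ext_vanishing_of_acyclic_onePeriodic
    (𝕜 : Type*) [Field 𝕜] [Finite 𝕜]
    (A : Type u) [Category.{v} A] [Abelian A] [EssentiallySmall.{w} A] [Linear 𝕜 A]
    [HasExt.{w} A] [HasExt.{w'} (OnePeriodic A)]
    (hereditary : ∀ (X Y : A) (p : ℕ), 2 ≤ p → Subsingleton (Abelian.Ext.{w} X Y p))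
    (K : OnePeriodic A) (hK : ∀ i, K.ExactAt i)
    (M : OnePeriodic A) (p : ℕ) (hp : 2 ≤ p) :
    Subsingleton (Abelian.Ext.{w'} K M p) ∧ Subsingleton (Abelian.Ext.{w'} M K p) := by
  have key₁ : ∀ (N : A) (X : OnePeriodic A)
      (_ : X ≅ (HomologicalComplex.single A (ComplexShape.up (ZMod 1)) 0).obj N)
      (α : Abelian.Ext.{w'} K X p), α = 0 := by
    intro N X e α
    obtain ⟨β, hβ⟩ := onePer_surj₁ N p K hK (α.comp (Abelian.Ext.mk₀ e.hom) (add_zero p))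
    have := hereditary (K.opcycles 0) N p hp
    obtain rfl := Subsingleton.elim β 0
    rw [Abelian.Ext.mapExactFunctor_zero, Abelian.Ext.comp_zero] at hβ
    have := congrArg (fun y => Abelian.Ext.comp y (Abelian.Ext.mk₀ e.inv) (add_zero p)) hβ
    simpa [Abelian.Ext.comp_assoc_of_third_deg_zero] using this
  have key₂ : ∀ (N : A) (X : OnePeriodic A)
      (_ : X ≅ (HomologicalComplex.single A (ComplexShape.up (ZMod 1)) 0).obj N)
      (α : Abelian.Ext.{w'} X K p), α = 0 := by
    intro N X e α
    obtain ⟨β, hβ⟩ := onePer_surj₂ N p K hK ((Abelian.Ext.mk₀ e.inv).comp α (zero_add p))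
    have := hereditary N (K.cycles 0) p hp
    obtain rfl := Subsingleton.elim β 0
    rw [Abelian.Ext.mapExactFunctor_zero, Abelian.Ext.zero_comp] at hβ
    have := congrArg (fun y => Abelian.Ext.comp (Abelian.Ext.mk₀ e.hom) y (zero_add p)) hβ
    simpa using this
  obtain ⟨S, hS, N₁, N₃, e₁, e₃, rfl⟩ := onePer_filtration M 0
  constructor
  · refine subsingleton_of_forall_eq 0 fun α => ?_
    obtain ⟨x, rfl⟩ := Abelian.Ext.covariant_sequence_exact₂ _ hS α (key₁ N₃ _ e₃ _)
    rw [key₁ N₁ _ e₁ x, Abelian.Ext.zero_comp]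
  · refine subsingleton_of_forall_eq 0 fun α => ?_
    obtain ⟨x, rfl⟩ := Abelian.Ext.contravariant_sequence_exact₂ hS _ α (key₂ N₁ _ e₁ _)
    rw [key₂ N₃ _ e₃ x, Abelian.Ext.comp_zero]
end

section
/- Let A be a hereditary abelian category and C_1(A) the category of 1-periodic complexes over A. For any acyclic 1-periodic complex K, the Ext-projective dimension of K in C_1(A) is at most 1, i.e., Ext^2_{C_1(A)}(K, -) = 0; conversely, if an object K of C_1(A) has finite Ext-projective dimension then K is acyclic. -/
open CategoryTheory

universe w w' v u

universe v' u'
open Limits Abelian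

section eff
variable {C : Type u} [Category.{v} C] [Abelian C]

open DerivedCategory in
theorem eff_aux [HasDerivedCategory.{w'} C] {X : C} (L : CochainComplex C ℤ) (hL : IsZero (L.X 0))
    (f : Q.obj ((HomologicalComplex.single C (.up ℤ) 0).obj X) ⟶ Q.obj L) :
    ∃ (X' : C) (p : X' ⟶ X), Epi p ∧
      Q.map ((HomologicalComplex.single C (.up ℤ) 0).map p) ≫ f = 0 := by
  have : CochainComplex.IsStrictlyLE ((HomologicalComplex.single C (.up ℤ) 0).obj X) 0 :=
    inferInstanceAs (CochainComplex.IsStrictlyLE ((CochainComplex.singleFunctor C 0).obj X) 0)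
  obtain ⟨K, hK, s, hs, g, rfl⟩ := right_fac_of_isStrictlyLE f 0
  let i : (HomologicalComplex.single C (.up ℤ) 0).obj (K.X 0) ⟶ K :=
    HomologicalComplex.mkHomFromSingle (𝟙 _) (fun k hk => by
      apply (K.isZero_of_isStrictlyLE 0 k (by simp at hk; lia)).eq_of_tgt)
  let p : K.X 0 ⟶ X := s.f 0 ≫ (HomologicalComplex.singleObjXSelf (.up ℤ) 0 X).hom
  have hp : (HomologicalComplex.single C (.up ℤ) 0).map p = i ≫ s := by
    apply HomologicalComplex.from_single_hom_ext
    have : (HomologicalComplex.Hom.f i 0) =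
        (HomologicalComplex.singleObjXSelf (.up ℤ) 0 (K.X 0)).hom := by
      simp [i, HomologicalComplex.mkHomFromSingle_f]
    rw [HomologicalComplex.comp_f, this, HomologicalComplex.single_map_f_self]
    simp [p]
  refine ⟨K.X 0, p, ?_, ?_⟩
  · rw [Preadditive.epi_iff_cancel_zero]
    intro Z q hq
    have h1 : s ≫ (HomologicalComplex.single C (.up ℤ) 0).map q = 0 := by
      apply HomologicalComplex.to_single_hom_ext
      rw [HomologicalComplex.comp_f, HomologicalComplex.single_map_f_self]
      simp only [p, Category.assoc] at hq
      rw [reassoc_of% hq]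
      simp
    have h2 : Q.map ((HomologicalComplex.single C (.up ℤ) 0).map q) = 0 := by
      rw [← cancel_epi (Q.map s), ← Functor.map_comp, h1, Functor.map_zero]
      exact comp_zero.symm
    apply (DerivedCategory.singleFunctor C 0).map_injective
    rw [Functor.map_zero]
    exact h2
  · rw [hp]
    have h3 : i ≫ g = 0 := by
      apply HomologicalComplex.from_single_hom_ext
      exact hL.eq_of_tgt _ _
    rw [Functor.map_comp, Category.assoc, IsIso.hom_inv_id_assoc, ← Functor.map_comp, h3,
      Functor.map_zero]

open DerivedCategory in
theorem Ext_eff [HasExt.{w} C] {X Y : C} {n : ℕ} (x : Ext X Y (n+1)) :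
    ∃ (X' : C) (p : X' ⟶ X), Epi p ∧ (Ext.mk₀ p).comp x (zero_add _) = 0 := by
  let := HasDerivedCategory.standard C
  let L : CochainComplex C ℤ := (HomologicalComplex.single C (.up ℤ) 0).obj Y
  have hL : IsZero ((L⟦((n+1:ℕ):ℤ)⟧).X 0) := by
    rw [CochainComplex.shiftFunctor_obj_X']
    apply HomologicalComplex.isZero_single_obj_X
    lia
  let e : (Q.obj L)⟦((n+1:ℕ):ℤ)⟧ ≅ Q.obj (L⟦((n+1:ℕ):ℤ)⟧) :=
    ((Q.commShiftIso ((n+1:ℕ):ℤ)).app L).symm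
  let x' : Q.obj ((HomologicalComplex.single C (.up ℤ) 0).obj X) ⟶ (Q.obj L)⟦((n+1:ℕ):ℤ)⟧ := x.hom
  obtain ⟨X', p, hp, h⟩ := eff_aux (X := X) _ hL (x' ≫ e.hom)
  refine ⟨X', p, hp, ?_⟩
  ext
  simp only [Ext.comp_hom, Ext.mk₀_hom, Ext.zero_hom, ShiftedHom.mk₀_comp]
  rw [← Category.assoc] at h
  have h' : Q.map ((HomologicalComplex.single C (.up ℤ) 0).map p) ≫ x' = 0 := by
    rw [← cancel_mono e.hom, h, zero_comp]
  exact h'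

theorem Ext_decomp [HasExt.{w} C] {X Y : C} {n : ℕ} (x : Ext X Y (n+1)) :
    ∃ (X' X'' : C) (i : X'' ⟶ X') (p : X' ⟶ X) (wz : i ≫ p = 0)
      (hS : (ShortComplex.mk i p wz).ShortExact) (y : Ext X'' Y n),
      x = hS.extClass.comp y (add_comm 1 n) := by
  obtain ⟨X', p, hp, h⟩ := Ext_eff x
  have hS : (ShortComplex.mk (kernel.ι p) p (by simp)).ShortExact :=
    { exact := ShortComplex.exact_kernel p }
  obtain ⟨y, hy⟩ := Ext.contravariant_sequence_exact₃ hS _ x h (add_comm 1 n)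
  exact ⟨X', _, _, p, _, hS, y, hy.symm⟩

variable {D : Type u'} [Category.{v'} D] [Abelian D]

theorem Ext_nat_ses [HasExt.{w} C] [HasExt.{w'} D] (U : C ⥤ D) (F : D ⥤ C) [U.Additive] [F.Additive]
    [PreservesFiniteLimits U] [PreservesFiniteColimits U]
    [PreservesFiniteLimits F] [PreservesFiniteColimits F] (ε : U ⋙ F ⟶ 𝟭 C)
    (S : ShortComplex C) (hS : S.ShortExact) :
    ((hS.extClass.mapExactFunctor U).mapExactFunctor F).comp
      (Ext.mk₀ (ε.app S.X₁)) (add_zero 1) =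
      (Ext.mk₀ (ε.app S.X₃)).comp hS.extClass (zero_add 1) := by
  let τ : (S.map U).map F ⟶ S :=
      { τ₁ := ε.app _, τ₂ := ε.app _, τ₃ := ε.app _
        comm₁₂ := (ε.naturality S.f).symm
        comm₂₃ := (ε.naturality S.g).symm }
  have key := ShortComplex.ShortExact.extClass_naturality
      ((hS.map_of_exact U).map_of_exact F) hS τ
  have h1 : (hS.extClass.mapExactFunctor U).mapExactFunctor F =
    ((hS.map_of_exact U).map_of_exact F).extClass := by
    rw [Ext.mapExactFunctor_extClass]
    exact Ext.mapExactFunctor_extClass F (hS.map_of_exact U)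
  rw [h1]
  exact key

theorem Ext_nat [HasExt.{w} C] [HasExt.{w'} D] (U : C ⥤ D) (F : D ⥤ C) [U.Additive] [F.Additive]
    [PreservesFiniteLimits U] [PreservesFiniteColimits U]
    [PreservesFiniteLimits F] [PreservesFiniteColimits F] (ε : U ⋙ F ⟶ 𝟭 C) {n : ℕ} :
    ∀ {X Y : C} (x : Ext X Y n),
    ((x.mapExactFunctor U).mapExactFunctor F).comp (Ext.mk₀ (ε.app Y)) (add_zero n) =
      (Ext.mk₀ (ε.app X)).comp x (zero_add n) := by
  induction n with
  | zero =>
    intro X Y x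
    obtain ⟨f, rfl⟩ := (Ext.mk₀_bijective X Y).2 x
    have := ε.naturality f
    dsimp at this
    rw [Ext.mapExactFunctor_mk₀, Ext.mapExactFunctor_mk₀]
    have h1 := Ext.mk₀_comp_mk₀ (F.map (U.map f)) (ε.app Y)
    have h2 := Ext.mk₀_comp_mk₀ (ε.app X) f
    refine Eq.trans h1 (Eq.trans ?_ h2.symm)
    rw [this]
  | succ n ih =>
    intro X Y x
    obtain ⟨X', X'', i, p, wz, hS, y, rfl⟩ := Ext_decomp x
    have key := Ext_nat_ses U F ε _ hS
    dsimp only at key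
    generalize hS.extClass = c at *
    dsimp only at c key ⊢
    rw [Ext.mapExactFunctor_comp, Ext.mapExactFunctor_comp,
      Ext.comp_assoc _ _ _ (add_comm 1 n) (add_zero n) (by lia), ih,
      ← Ext.comp_assoc _ _ _ (add_zero 1) (zero_add n) (by lia)]
    erw [key]
    rw [Ext.comp_assoc _ _ _ (zero_add 1) (add_comm 1 n) (by lia)]
end eff

section onePeriodic
variable {A : Type u} [Category.{v} A] [Abelian A]

namespace OneP

/-- The 1-periodic complex attached to a square-zero endomorphism. -/
def mk (X : A) (d : X ⟶ X) (h : d ≫ d = 0) : OnePeriodic A where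
  X _ := X
  d _ _ := d
  shape i j hij := (hij (Subsingleton.elim _ _)).elim
  d_comp_d' _ _ _ _ _ := h

theorem eq_mk (K : OnePeriodic A) : ∃ (X : A) (d : X ⟶ X) (h : d ≫ d = 0), K = mk X d h := by
  obtain ⟨X, d, h1, h2⟩ := K
  obtain ⟨X0, rfl⟩ : ∃ X0, X = fun _ => X0 :=
    ⟨X 0, funext fun i => congrArg X (Subsingleton.elim _ _)⟩
  obtain ⟨d0, rfl⟩ : ∃ d0 : X0 ⟶ X0, d = fun _ _ => d0 :=
    ⟨d 0 0, funext fun i => funext fun j => by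
      obtain rfl : i = 0 := Subsingleton.elim _ _
      obtain rfl : j = 0 := Subsingleton.elim _ _
      rfl⟩
  exact ⟨X0, d0, h2 0 0 0 (Subsingleton.elim _ _) (Subsingleton.elim _ _), rfl⟩

theorem hom_ext {K L : OnePeriodic A} (f g : K ⟶ L) (h : f.f 0 = g.f 0) : f = g := by
  ext i
  obtain rfl : i = 0 := Subsingleton.elim _ _
  exact h

theorem exactAt_iff (K : OnePeriodic A) (i : ZMod 1) :
    K.ExactAt i ↔ (ShortComplex.mk (K.d 0 0) (K.d 0 0) (K.d_comp_d 0 0 0)).Exact := by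
  obtain rfl : i = 0 := Subsingleton.elim _ _
  exact K.exactAt_iff' 0 0 0 (Subsingleton.elim _ _) (Subsingleton.elim _ _)

theorem mk_exactAt_iff (X : A) (d : X ⟶ X) (h : d ≫ d = 0) (i : ZMod 1) :
    (mk X d h).ExactAt i ↔ (ShortComplex.mk d d h).Exact := exactAt_iff _ _

/-- Morphisms between objects of the form `mk`. -/
def mkHom {X Y : A} {d : X ⟶ X} {h : d ≫ d = 0} {d' : Y ⟶ Y} {h' : d' ≫ d' = 0}
    (f : X ⟶ Y) (hf : f ≫ d' = d ≫ f) : mk X d h ⟶ mk Y d' h' where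
  f _ := f
  comm' _ _ _ := hf

/-- zero differential -/
def Z0 : A ⥤ OnePeriodic A where
  obj X := mk X 0 comp_zero
  map f := mkHom f (by simp)

/-- the free functor -/
noncomputable def F : A ⥤ OnePeriodic A where
  obj X := mk (X ⊞ X) (biprod.fst ≫ biprod.inr) (by simp)
  map f := mkHom (biprod.map f f) (by simp)
  map_id X := by
    apply hom_ext
    change biprod.map (𝟙 X) (𝟙 X) = 𝟙 (X ⊞ X)
    ext <;> simp
  map_comp f g := by
    apply hom_ext
    change biprod.map (f ≫ g) (f ≫ g) = biprod.map f f ≫ biprod.map g g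
    ext <;> simp

instance : (Z0 (A := A)).Additive where
  map_add := rfl

instance : (F (A := A)).Additive where
  map_add {X Y f g} := by
    apply hom_ext
    change biprod.map (f + g) (f + g) = biprod.map f f + biprod.map g g
    ext <;> simp

instance : PreservesFiniteLimits (Z0 (A := A)) := ⟨fun J _ _ =>
  HomologicalComplex.preservesLimitsOfShape_of_eval _ (fun i =>
    inferInstanceAs (PreservesLimitsOfShape J (𝟭 A)))⟩

instance : PreservesFiniteColimits (Z0 (A := A)) := ⟨fun J _ _ =>
  HomologicalComplex.preservesColimitsOfShape_of_eval _ (fun i =>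
    inferInstanceAs (PreservesColimitsOfShape J (𝟭 A)))⟩

/-- the doubling functor -/
noncomputable def G : A ⥤ A where
  obj X := X ⊞ X
  map f := biprod.map f f

/-- doubling is self-adjoint -/
noncomputable def adj : (G (A := A)) ⊣ G :=
  Adjunction.mkOfUnitCounit
    { unit :=
        { app := fun X => (biprod.lift biprod.inl biprod.inr : X ⟶ (X ⊞ X) ⊞ (X ⊞ X))
          naturality := fun X Y f => by
            change f ≫ biprod.lift biprod.inl biprod.inr =
              biprod.lift biprod.inl biprod.inr ≫
                biprod.map (biprod.map f f) (biprod.map f f)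
            ext <;> simp }
      counit :=
        { app := fun X => (biprod.desc biprod.fst biprod.snd : (X ⊞ X) ⊞ (X ⊞ X) ⟶ X)
          naturality := fun X Y f => by
            change biprod.map (biprod.map f f) (biprod.map f f) ≫
              biprod.desc biprod.fst biprod.snd = biprod.desc biprod.fst biprod.snd ≫ f
            ext <;> simp }
      left_triangle := by
        ext X
        change biprod.map (biprod.lift biprod.inl biprod.inr) (biprod.lift biprod.inl biprod.inr) ≫
          𝟙 _ ≫ biprod.desc biprod.fst biprod.snd = 𝟙 (X ⊞ X)
        ext <;> simp
      right_triangle := by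
        ext X
        change biprod.lift biprod.inl biprod.inr ≫
          𝟙 _ ≫ biprod.map (biprod.desc biprod.fst biprod.snd)
            (biprod.desc biprod.fst biprod.snd) = 𝟙 (X ⊞ X)
        ext <;> simp }

instance : PreservesFiniteLimits (F (A := A)) := ⟨fun J _ _ =>
  HomologicalComplex.preservesLimitsOfShape_of_eval _ (fun i => by
    have : PreservesLimitsOfShape J (G (A := A)) :=
      adj.rightAdjoint_preservesLimits.preservesLimitsOfShape
    exact this)⟩

instance : PreservesFiniteColimits (F (A := A)) := ⟨fun J _ _ =>
  HomologicalComplex.preservesColimitsOfShape_of_eval _ (fun i => by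
    have : PreservesColimitsOfShape J (G (A := A)) :=
      adj.leftAdjoint_preservesColimits.preservesColimitsOfShape
    exact this)⟩

/-- evaluation -/
abbrev U : OnePeriodic A ⥤ A := HomologicalComplex.eval A (ComplexShape.up (ZMod 1)) 0

/-- the counit at an object -/
noncomputable def counitApp (K : OnePeriodic A) : F.obj (K.X 0) ⟶ K where
  f i := biprod.desc (K.XIsoOfEq (Subsingleton.elim _ _)).hom (K.d 0 i)
  comm' i j _ := by
    obtain rfl : i = 0 := Subsingleton.elim _ _
    obtain rfl : j = 0 := Subsingleton.elim _ _
    dsimp [F, mk]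
    ext <;> simp

/-- the counit -/
noncomputable def counit : U ⋙ F ⟶ 𝟭 (OnePeriodic A) where
  app K := counitApp K
  naturality K L f := by
    apply hom_ext
    change biprod.map (f.f 0) (f.f 0) ≫ biprod.desc (𝟙 _) (L.d 0 0) =
      biprod.desc (𝟙 _) (K.d 0 0) ≫ f.f 0
    ext <;> simp

theorem F_section (X : A) : F.map biprod.inl ≫ counit.app (F.obj X) = 𝟙 _ := by
  apply hom_ext
  change biprod.map biprod.inl biprod.inl ≫ biprod.desc (𝟙 _) (biprod.fst ≫ biprod.inr) =
    𝟙 (X ⊞ X)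
  ext <;> simp

theorem Ext_F [HasExt.{w} A] [HasExt.{w'} (OnePeriodic A)]
    (X : A) (M : OnePeriodic A) (n : ℕ) (h : Subsingleton (Ext.{w} (X ⊞ X) (M.X 0) n)) :
    Subsingleton (Ext.{w'} (F.obj X) M n) := by
  suffices ∀ x : Ext.{w'} (F.obj X) M n, x = 0 from ⟨fun a b => by rw [this a, this b]⟩
  intro x
  have h0 : (x.mapExactFunctor U : Ext.{w} (U.obj (F.obj X)) (U.obj M) n) = 0 :=
    Subsingleton.elim (α := Ext.{w} (X ⊞ X) (M.X 0) n) _ _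
  have h1 := Ext_nat.{w', w} U F counit x
  rw [h0, Ext.mapExactFunctor_zero, Ext.zero_comp] at h1
  have h2 := Ext.mk₀_comp_mk₀_assoc (F.map biprod.inl) (counit.app (F.obj X)) x
  erw [← h1] at h2
  rw [F_section, Ext.mk₀_id_comp] at h2
  exact h2.symm.trans (Ext.comp_zero _ _ _ _ _)

theorem neg_sq {X : A} {d : X ⟶ X} (h : d ≫ d = 0) : (-d) ≫ (-d) = 0 := by simp [h]

/-- inclusion of the twist -/
noncomputable def iota (X : A) (d : X ⟶ X) (h : d ≫ d = 0) : mk X (-d) (neg_sq h) ⟶ F.obj X :=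
  mkHom (biprod.lift (-d) (𝟙 X)) (by ext <;> simp [h])

/-- projection -/
noncomputable def eps (X : A) (d : X ⟶ X) (h : d ≫ d = 0) : F.obj X ⟶ mk X d h :=
  mkHom (biprod.desc (𝟙 X) d) (by ext <;> simp [h])

theorem iota_eps (X : A) (d : X ⟶ X) (h : d ≫ d = 0) : iota X d h ≫ eps X d h = 0 := by
  apply hom_ext
  change biprod.lift (-d) (𝟙 X) ≫ biprod.desc (𝟙 X) d = 0
  simp

theorem ses (X : A) (d : X ⟶ X) (h : d ≫ d = 0) :
    (ShortComplex.mk _ _ (iota_eps X d h)).ShortExact := by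
  apply HomologicalComplex.shortExact_of_degreewise_shortExact
  intro i
  have w0 : biprod.lift (-d) (𝟙 X) ≫ biprod.desc (𝟙 X) d = 0 := by simp
  let σ : (ShortComplex.mk _ _ w0).Splitting :=
    { r := biprod.snd
      s := biprod.inl
      f_r := by simp
      s_g := by simp
      id := by
        dsimp
        ext <;> simp }
  exact σ.shortExact

theorem F_exact (X : A) :
    (ShortComplex.mk (biprod.fst ≫ biprod.inr : X ⊞ X ⟶ X ⊞ X)
      (biprod.fst ≫ biprod.inr : X ⊞ X ⟶ X ⊞ X) (by simp)).Exact := by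
  rw [ShortComplex.exact_iff_exact_up_to_refinements]
  intro T x hx
  dsimp at x hx
  have hx' : x ≫ biprod.fst = 0 := by
    have := hx =≫ biprod.snd
    simpa using this
  refine ⟨T, 𝟙 T, inferInstance, biprod.lift (x ≫ biprod.snd) 0, ?_⟩
  dsimp
  ext <;> simp [hx']

theorem neg_exact {X : A} {d : X ⟶ X} (h : d ≫ d = 0)
    (H : (ShortComplex.mk _ _ (neg_sq h)).Exact) : (ShortComplex.mk d d h).Exact := by
  rw [ShortComplex.exact_iff_exact_up_to_refinements] at H ⊢
  intro T x hx
  dsimp at x hx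
  obtain ⟨T', π, hπ, y, hy⟩ := H x (by simp [hx])
  exact ⟨T', π, hπ, -y, by simpa using hy⟩

theorem chase {K L L' P W : OnePeriodic A} (ι : K ⟶ L) (p : W ⟶ L) [Epi p] (a : P ⟶ W) (b : P ⟶ K)
    (sq : IsPullback a b p ι) (l : P ⟶ L') (e : L' ⟶ K) (hl : l ≫ e = b)
    (hL : (ShortComplex.mk (L.d 0 0) (L.d 0 0) (L.d_comp_d 0 0 0)).Exact)
    (hL' : (ShortComplex.mk (L'.d 0 0) (L'.d 0 0) (L'.d_comp_d 0 0 0)).Exact) :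
    (ShortComplex.mk (K.d 0 0) (K.d 0 0) (K.d_comp_d 0 0 0)).Exact := by
  rw [ShortComplex.exact_iff_exact_up_to_refinements] at hL hL' ⊢
  intro T x hx
  dsimp at x hx hL hL' ⊢
  obtain ⟨T1, π1, _, y, hy⟩ := hL (x ≫ ι.f 0) (by simp [reassoc_of% hx])
  have : Epi (p.f 0) := inferInstanceAs (Epi (U.map p))
  obtain ⟨T2, π2, _, z, hz⟩ := surjective_up_to_refinements_of_epi (p.f 0) y
  have sq' : IsPullback (a.f 0) (b.f 0) (p.f 0) (ι.f 0) := sq.map U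
  have hc : (z ≫ W.d 0 0) ≫ p.f 0 = (π2 ≫ π1 ≫ x) ≫ ι.f 0 := by
    simp [hy, reassoc_of% hz]
  let t := sq'.lift _ _ hc
  have ht1 : t ≫ a.f 0 = z ≫ W.d 0 0 := sq'.lift_fst _ _ hc
  have ht2 : t ≫ b.f 0 = π2 ≫ π1 ≫ x := sq'.lift_snd _ _ hc
  have htd : t ≫ P.d 0 0 = 0 := by
    apply sq'.hom_ext
    · rw [Category.assoc, ← a.comm, reassoc_of% ht1]; simp
    · rw [Category.assoc, ← b.comm, reassoc_of% ht2]; simp [hx]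
  obtain ⟨T3, π3, _, q, hq⟩ := hL' (t ≫ l.f 0) (by simp [reassoc_of% htd])
  refine ⟨T3, π3 ≫ π2 ≫ π1, inferInstance, q ≫ e.f 0, ?_⟩
  have hl0 : l.f 0 ≫ e.f 0 = b.f 0 := by rw [← hl]; rfl
  simp only [Category.assoc]
  rw [← ht2, ← hl0, e.comm, ← reassoc_of% hq]

/-- Base case of the converse. -/
theorem base [HasExt.{w'} (OnePeriodic A)] (X : A) (d : X ⟶ X) (h : d ≫ d = 0)
    (H : ∀ M, Subsingleton (Ext.{w'} (mk X d h) M 2)) : (ShortComplex.mk d d h).Exact := by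
  apply neg_exact h
  let S := ses X d h
  let S' := ses X (-d) (neg_sq h)
  obtain ⟨z, hz⟩ := Ext.contravariant_sequence_exact₁ S _ S'.extClass (n₁ := 2) rfl
    ((H _).elim _ _)
  dsimp only at z hz
  obtain ⟨W, p, hp, hpz⟩ := Ext_eff (n := 0) z
  have sq := IsPullback.of_hasPullback p (iota X d h)
  have hl : (Ext.mk₀ (pullback.snd p (iota X d h))).comp S'.extClass (zero_add 1) = 0 := by
    rw [← hz]
    refine (Ext.mk₀_comp_mk₀_assoc _ _ _).trans ?_
    rw [← pullback.condition]
    refine (Ext.mk₀_comp_mk₀_assoc _ _ _).symm.trans ?_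
    refine Eq.trans (congrArg (fun t => (Ext.mk₀ (pullback.fst p (iota X d h))).comp t (zero_add 1)) hpz) ?_
    exact Ext.comp_zero _ _ _ _ _
  obtain ⟨l0, hl0⟩ := Ext.covariant_sequence_exact₃ _ S' _ rfl hl
  obtain ⟨l, rfl⟩ := (Ext.mk₀_bijective _ _).2 l0
  rw [Ext.mk₀_comp_mk₀] at hl0
  have hl1 : l ≫ eps X (-d) (neg_sq h) = pullback.snd p (iota X d h) :=
    (Ext.mk₀_bijective _ _).1 hl0
  exact chase (iota X d h) p _ _ sq l _ hl1 (F_exact X) (F_exact X)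

theorem Ext_F' [HasExt.{w} A] [HasExt.{w'} (OnePeriodic A)]
    (hereditary : ∀ (X Y : A) (p : ℕ), 2 ≤ p → Subsingleton (Abelian.Ext.{w} X Y p))
    (X : A) (M : OnePeriodic A) (n : ℕ) (hn : 2 ≤ n) (x : Ext.{w'} (F.obj X) M n) : x = 0 :=
  (Ext_F X M n (hereditary _ _ _ hn)).elim _ _

theorem converse_aux [HasExt.{w} A] [HasExt.{w'} (OnePeriodic A)]
    (hereditary : ∀ (X Y : A) (p : ℕ), 2 ≤ p → Subsingleton (Abelian.Ext.{w} X Y p)) (q : ℕ) :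
    ∀ (X : A) (d : X ⟶ X) (h : d ≫ d = 0)
      (_ : ∀ M, Subsingleton (Ext.{w'} (mk X d h) M (q + 2))), (ShortComplex.mk d d h).Exact := by
  induction q with
  | zero => exact base
  | succ q ih =>
    intro X d h H
    apply neg_exact h
    apply ih
    intro M
    suffices ∀ x : Ext.{w'} (mk X (-d) (neg_sq h)) M (q + 2), x = 0 from
      ⟨fun a b => by rw [this a, this b]⟩
    intro x
    obtain ⟨z, hz⟩ := Ext.contravariant_sequence_exact₁ (ses X d h) _ x (n₁ := q + 1 + 2) (by lia)
      ((H _).elim _ _)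
    rw [← hz, Ext_F' hereditary X M _ (by lia) z]
    exact Ext.comp_zero _ _ _ _ _

theorem map_ext_comp {C : Type u} [Category.{v} C] [Abelian C] {D : Type u'} [Category.{v'} D]
    [Abelian D] [HasExt.{w} C] [HasExt.{w'} D] (F : C ⥤ D) [F.Additive]
    [PreservesFiniteLimits F] [PreservesFiniteColimits F] {S : ShortComplex C} (hS : S.ShortExact)
    {Y : C} (ψ : S.X₁ ⟶ Y) :
    (hS.extClass.comp (Ext.mk₀ ψ) (add_zero 1)).mapExactFunctor F =
      (hS.map_of_exact F).extClass.comp (Ext.mk₀ (F.map ψ)) (add_zero 1) := by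
  rw [Ext.mapExactFunctor_comp, Ext.mapExactFunctor_mk₀, Ext.mapExactFunctor_extClass]
  rfl

/-- cokernel of the differential -/
noncomputable def Co : OnePeriodic A ⥤ A where
  obj K := cokernel (K.d 0 0)
  map f := cokernel.map _ _ (f.f 0) (f.f 0) (by simp)
  map_id K := by ext; simp
  map_comp f g := by ext; simp

instance : (Co (A := A)).PreservesZeroMorphisms where
  map_zero K L := by
    refine (cancel_epi (cokernel.π (K.d 0 0))).1 ?_
    refine (cokernel.π_desc _ _ _).trans ?_
    rw [HomologicalComplex.zero_f, zero_comp]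
    exact comp_zero.symm

/-- projection to the cokernel of the differential -/
noncomputable def toZApp (K : OnePeriodic A) : K ⟶ Z0.obj (Co.obj K) where
  f i := (K.XIsoOfEq (Subsingleton.elim _ _)).hom ≫ cokernel.π (K.d 0 0)
  comm' i j _ := by
    obtain rfl : i = 0 := Subsingleton.elim _ _
    obtain rfl : j = 0 := Subsingleton.elim _ _
    change (𝟙 _ ≫ cokernel.π (K.d 0 0)) ≫ 0 = K.d 0 0 ≫ 𝟙 _ ≫ cokernel.π (K.d 0 0)
    simp

/-- natural projection -/
noncomputable def toZ : 𝟭 (OnePeriodic A) ⟶ Co ⋙ Z0 where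
  app K := toZApp K
  naturality K L f := by
    apply hom_ext
    change f.f 0 ≫ 𝟙 _ ≫ cokernel.π (L.d 0 0) =
      (𝟙 _ ≫ cokernel.π (K.d 0 0)) ≫ cokernel.map _ _ (f.f 0) (f.f 0) (by simp)
    simp

theorem coker_lift {X Y : A} (f : X ⟶ Y) {T : A} (x : T ⟶ Y) (hx : x ≫ cokernel.π f = 0) :
    ∃ (T' : A) (π : T' ⟶ T) (_ : Epi π) (y : T' ⟶ X), π ≫ x = y ≫ f :=
  (ShortComplex.exact_iff_exact_up_to_refinements _).1 (ShortComplex.exact_cokernel f) x hx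

theorem coker_exact {X₁ X₂ X₃ C₁ C₂ C₃ : A} {d₁ : X₁ ⟶ X₁} {d₂ : X₂ ⟶ X₂} {d₃ : X₃ ⟶ X₃}
    {f : X₁ ⟶ X₂} {g : X₂ ⟶ X₃} (hfg : f ≫ g = 0) [Mono f] [Epi g]
    (hex : ∀ ⦃T : A⦄ (x : T ⟶ X₂), x ≫ g = 0 → ∃ y : T ⟶ X₁, x = y ≫ f)
    (fd : f ≫ d₂ = d₁ ≫ f) (gd : g ≫ d₃ = d₂ ≫ g)
    (h3 : ∀ ⦃T : A⦄ (x : T ⟶ X₃), x ≫ d₃ = 0 → ∃ (T' : A) (π : T' ⟶ T) (_ : Epi π)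
      (y : T' ⟶ X₃), π ≫ x = y ≫ d₃)
    (p₁ : X₁ ⟶ C₁) (p₂ : X₂ ⟶ C₂) (p₃ : X₃ ⟶ C₃) [Epi p₁] [Epi p₂] [Epi p₃]
    (dp₁ : d₁ ≫ p₁ = 0) (dp₂ : d₂ ≫ p₂ = 0) (dd₂ : d₂ ≫ d₂ = 0)
    (l₂ : ∀ ⦃T : A⦄ (x : T ⟶ X₂), x ≫ p₂ = 0 → ∃ (T' : A) (π : T' ⟶ T) (_ : Epi π)
      (y : T' ⟶ X₂), π ≫ x = y ≫ d₂)
    (l₃ : ∀ ⦃T : A⦄ (x : T ⟶ X₃), x ≫ p₃ = 0 → ∃ (T' : A) (π : T' ⟶ T) (_ : Epi π)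
      (y : T' ⟶ X₃), π ≫ x = y ≫ d₃)
    (f' : C₁ ⟶ C₂) (g' : C₂ ⟶ C₃) (e1 : p₁ ≫ f' = f ≫ p₂) (e2 : p₂ ≫ g' = g ≫ p₃)
    (w : f' ≫ g' = 0) : (ShortComplex.mk f' g' w).ShortExact := by
  refine { exact := ?_, mono_f := ?_, epi_g := ?_ }
  · rw [ShortComplex.exact_iff_exact_up_to_refinements]
    intro T x hx
    dsimp at x hx ⊢
    obtain ⟨T1, π1, _, w, hw⟩ := surjective_up_to_refinements_of_epi p₂ x
    obtain ⟨T2, π2, _, e, he⟩ := l₃ (w ≫ g) (by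
      rw [Category.assoc, ← e2, ← reassoc_of% hw, hx, comp_zero])
    obtain ⟨T3, π3, _, e', he'⟩ := surjective_up_to_refinements_of_epi g e
    obtain ⟨y, hy⟩ := hex (π3 ≫ π2 ≫ w - e' ≫ d₂) (by
      simp [he, reassoc_of% he', gd])
    refine ⟨T3, π3 ≫ π2 ≫ π1, inferInstance, y ≫ p₁, ?_⟩
    rw [Category.assoc y, e1, ← Category.assoc y, ← hy]
    simp [dp₂, hw]
  · rw [Preadditive.mono_iff_cancel_zero]
    intro T x hx
    dsimp at x hx
    obtain ⟨T1, π1, _, w, hw⟩ := surjective_up_to_refinements_of_epi p₁ x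
    obtain ⟨T2, π2, _, e, he⟩ := l₂ (w ≫ f) (by
      rw [Category.assoc, ← e1, ← reassoc_of% hw, hx, comp_zero])
    obtain ⟨T3, π3, _, c, hc⟩ := h3 (e ≫ g) (by
      rw [Category.assoc, gd, ← Category.assoc, ← he]
      simp [hfg])
    obtain ⟨T4, π4, _, e', he'⟩ := surjective_up_to_refinements_of_epi g c
    obtain ⟨y, hy⟩ := hex (π4 ≫ π3 ≫ e - e' ≫ d₂) (by
      simp [hc, reassoc_of% he', gd])
    obtain ⟨T5, π5, _, y', hy'⟩ : ∃ (T' : A) (π : T' ⟶ T4) (_ : Epi π) (y : T' ⟶ X₁),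
        π ≫ π4 ≫ π3 ≫ π2 ≫ w = y ≫ d₁ := by
      refine ⟨T4, 𝟙 _, inferInstance, y, ?_⟩
      rw [← cancel_mono f]
      simp only [Category.assoc, Category.id_comp]
      rw [← fd, ← Category.assoc y, ← hy]
      simp [he, dd₂]
    rw [← cancel_epi (π5 ≫ π4 ≫ π3 ≫ π2 ≫ π1), comp_zero]
    simp only [Category.assoc]
    rw [hw, reassoc_of% hy', dp₁, comp_zero]
  · have : Epi (p₂ ≫ g') := by rw [e2]; exact epi_comp _ _
    exact epi_of_epi p₂ g'

theorem Co_exact (S : ShortComplex (OnePeriodic A)) (hS : S.ShortExact)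
    (h3 : (ShortComplex.mk (S.X₃.d 0 0) (S.X₃.d 0 0) (S.X₃.d_comp_d 0 0 0)).Exact) :
    (S.map Co).ShortExact := by
  have hS0 : (S.map U).ShortExact := hS.map_of_exact U
  have hf : Mono (S.f.f 0) := hS0.mono_f
  have hg : Epi (S.g.f 0) := hS0.epi_g
  have hfg : S.f.f 0 ≫ S.g.f 0 = 0 := (S.map U).zero
  have hex : ∀ ⦃T : A⦄ (x : T ⟶ S.X₂.X 0), x ≫ S.g.f 0 = 0 →
      ∃ y : T ⟶ S.X₁.X 0, x = y ≫ S.f.f 0 := fun T x hx =>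
    have : Mono (S.map U).f := hf
    ⟨hS0.exact.lift x hx, (hS0.exact.lift_f x hx).symm⟩
  rw [ShortComplex.exact_iff_exact_up_to_refinements] at h3
  exact coker_exact hfg hex (S.f.comm 0 0) (S.g.comm 0 0) h3
    (cokernel.π (S.X₁.d 0 0)) (cokernel.π (S.X₂.d 0 0)) (cokernel.π (S.X₃.d 0 0))
    (cokernel.condition _) (cokernel.condition _) (S.X₂.d_comp_d 0 0 0)
    (fun _ x hx => coker_lift _ x hx) (fun _ x hx => coker_lift _ x hx)
    (Co.map S.f) (Co.map S.g) (cokernel.π_desc _ _ _) (cokernel.π_desc _ _ _) (S.map Co).zero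

theorem Z0_factor (K : OnePeriodic A) (Y : A) (φ : K ⟶ Z0.obj Y) :
    ∃ ψ : Co.obj K ⟶ Y, φ = toZ.app K ≫ Z0.map ψ := by
  have hφ : K.d 0 0 ≫ φ.f 0 = 0 := by
    rw [← φ.comm 0 0]
    exact comp_zero
  refine ⟨cokernel.desc _ (φ.f 0) hφ, ?_⟩
  apply hom_ext
  change φ.f 0 = (𝟙 _ ≫ cokernel.π (K.d 0 0)) ≫ cokernel.desc _ (φ.f 0) hφ
  simp

/-- Ext¹ from an exact complex to a zero-differential one comes from `A`. -/
theorem Ext1_Z0 [HasExt.{w} A] [HasExt.{w'} (OnePeriodic A)] (K : OnePeriodic A)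
    (hK : (ShortComplex.mk (K.d 0 0) (K.d 0 0) (K.d_comp_d 0 0 0)).Exact) (Y : A)
    (α : Ext.{w'} K (Z0.obj Y) 1) :
    ∃ β : Ext.{w} (Co.obj K) Y 1,
      α = (Ext.mk₀ (toZ.app K)).comp (β.mapExactFunctor Z0) (zero_add 1) := by
  obtain ⟨W, k, i, p, wz, hS, y, rfl⟩ := Ext_decomp (n := 0) α
  obtain ⟨φ, rfl⟩ := (Ext.mk₀_bijective _ _).2 y
  obtain ⟨ψ, rfl⟩ := Z0_factor k Y φ
  have hC := Co_exact _ hS hK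
  let τ : ShortComplex.mk i p wz ⟶ ((ShortComplex.mk i p wz).map Co).map Z0 :=
    { τ₁ := toZ.app _, τ₂ := toZ.app _, τ₃ := toZ.app _
      comm₁₂ := (toZ.naturality i).symm
      comm₂₃ := (toZ.naturality p).symm }
  have key := ShortComplex.ShortExact.extClass_naturality hS (hC.map_of_exact Z0) τ
  refine ⟨hC.extClass.comp (Ext.mk₀ ψ) (add_zero 1), ?_⟩
  have h2 : (hC.extClass.comp (Ext.mk₀ ψ) (add_zero 1)).mapExactFunctor Z0 =
      (hC.map_of_exact Z0).extClass.comp (Ext.mk₀ (Z0.map ψ)) (add_zero 1) :=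
    map_ext_comp Z0 hC ψ
  refine Eq.trans ?_ (congrArg (fun t => (Ext.mk₀ (toZ.app K)).comp t (zero_add 1)) h2.symm)
  have e1 := Ext.comp_assoc (Ext.mk₀ (toZ.app K)) (hC.map_of_exact Z0).extClass
    (Ext.mk₀ (Z0.map ψ)) (zero_add 1) (add_zero 1) (add_zero 1)
  refine Eq.trans ?_ e1
  have e2 := congrArg (fun t => t.comp (Ext.mk₀ (Z0.map ψ)) (add_zero 1)) key
  refine Eq.trans ?_ e2
  have e3 := Ext.comp_assoc hS.extClass (Ext.mk₀ (toZ.app k))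
    (Ext.mk₀ (Z0.map ψ)) (add_zero 1) (add_zero 0) (add_zero 1)
  refine Eq.trans ?_ e3.symm
  have e4 := Ext.mk₀_comp_mk₀ (toZ.app k) (Z0.map ψ)
  exact congrArg (fun t => hS.extClass.comp t (add_zero 1)) e4.symm

/-- first projection -/
noncomputable def fstF (X : A) : F.obj X ⟶ Z0.obj X :=
  mkHom biprod.fst (by simp)

theorem stepY [HasExt.{w} A] [HasExt.{w'} (OnePeriodic A)]
    (hereditary : ∀ (X Y : A) (p : ℕ), 2 ≤ p → Subsingleton (Abelian.Ext.{w} X Y p))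
    (X : A) (d : X ⟶ X) (h : d ≫ d = 0) (H : (ShortComplex.mk d d h).Exact) (Y : A)
    (x : Ext.{w'} (mk X d h) (Z0.obj Y) 2) : x = 0 := by
  obtain ⟨α, hα⟩ := Ext.contravariant_sequence_exact₃ (ses X d h) _ x
    (Ext_F' hereditary X _ 2 le_rfl _) (n₀ := 1) rfl
  have H' : (ShortComplex.mk (-d) (-d) (neg_sq h)).Exact := by
    apply neg_exact (neg_sq h)
    simpa using H
  obtain ⟨β, hβ⟩ := Ext1_Z0.{w} (mk X (-d) (neg_sq h)) H' Y α
  let j : Co.obj (mk X (-d) (neg_sq h)) ⟶ X := cokernel.desc (-d) (-d) (neg_sq h)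
  have hj : cokernel.π (-d) ≫ j = -d := cokernel.π_desc _ _ _
  have : Mono j := by
    exact H'.mono_cokernelDesc
  have hJ : (ShortComplex.mk j (cokernel.π j) (by simp)).ShortExact :=
    { exact := ShortComplex.exact_cokernel j }
  obtain ⟨γ, hγ⟩ := Ext.contravariant_sequence_exact₁ hJ _ β (n₁ := 2) rfl
    ((hereditary _ _ 2 le_rfl).elim _ _)
  have hfac : toZ.app (mk X (-d) (neg_sq h)) ≫ Z0.map j = iota X d h ≫ fstF X := by
    apply hom_ext
    change (𝟙 _ ≫ cokernel.π (-d)) ≫ j = biprod.lift (-d) (𝟙 X) ≫ biprod.fst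
    rw [Category.id_comp, hj, biprod.lift_fst]
  have hα2 : α = (Ext.mk₀ (iota X d h)).comp
      ((Ext.mk₀ (fstF X)).comp (γ.mapExactFunctor Z0) (zero_add 1)) (zero_add 1) := by
    refine Eq.trans ?_ (Ext.mk₀_comp_mk₀_assoc _ _ _).symm
    rw [← hfac]
    refine Eq.trans ?_ (Ext.mk₀_comp_mk₀_assoc _ _ _)
    rw [hβ, ← hγ]
    refine congrArg (fun t => (Ext.mk₀ (toZ.app (mk X (-d) (neg_sq h)))).comp t (zero_add 1)) ?_
    rw [← Ext.mapExactFunctor_mk₀]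
    exact Ext.mapExactFunctor_comp _ _ _ _
  rw [← hα, hα2]
  exact (ses X d h).extClass_comp_assoc _

theorem filt {Y : A} (d : Y ⟶ Y) (h : d ≫ d = 0) :
    ∃ (B C : A) (i : Z0.obj B ⟶ mk Y d h) (q : mk Y d h ⟶ Z0.obj C) (hz : i ≫ q = 0),
      (ShortComplex.mk i q hz).ShortExact := by
  have h1 : kernel.ι d ≫ d = 0 := kernel.condition d
  have h2 : d ≫ cokernel.π (kernel.ι d) = 0 := by
    have := kernel.lift_ι d d h =≫ cokernel.π (kernel.ι d)
    rw [Category.assoc, cokernel.condition, comp_zero] at this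
    exact this.symm
  refine ⟨kernel d, cokernel (kernel.ι d), mkHom (kernel.ι d) (by simp),
    mkHom (cokernel.π (kernel.ι d)) (by simp [h2]), ?_, ?_⟩
  · apply hom_ext
    exact cokernel.condition (kernel.ι d)
  · apply HomologicalComplex.shortExact_of_degreewise_shortExact
    intro i
    have : (ShortComplex.mk (kernel.ι d) (cokernel.π (kernel.ι d)) (by simp)).ShortExact :=
      { exact := ShortComplex.exact_cokernel _ }
    exact this

theorem forward [HasExt.{w} A] [HasExt.{w'} (OnePeriodic A)]
    (hereditary : ∀ (X Y : A) (p : ℕ), 2 ≤ p → Subsingleton (Abelian.Ext.{w} X Y p))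
    (X : A) (d : X ⟶ X) (h : d ≫ d = 0) (H : (ShortComplex.mk d d h).Exact) (M : OnePeriodic A)
    (x : Ext.{w'} (mk X d h) M 2) : x = 0 := by
  obtain ⟨Y, d', h', rfl⟩ := eq_mk M
  obtain ⟨B, C, i, q, hz, hS⟩ := filt d' h'
  obtain ⟨y, hy⟩ := Ext.covariant_sequence_exact₂ _ hS x (stepY hereditary X d h H C _)
  have hy0 : y = 0 := stepY hereditary X d h H B y
  rw [← hy, hy0]
  exact Ext.zero_comp (C := OnePeriodic A) _ _ (Ext.mk₀ i) _ _

end OneP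
end onePeriodic

/-- Let `A` be a hereditary abelian category and `C₁(A)` the category of 1-periodic
complexes.  Any acyclic 1-periodic complex `K` has Ext-projective dimension at most `1`,
i.e. `Ext²_{C₁(A)}(K, -) = 0`; conversely, if `K ∈ C₁(A)` has finite Ext-projective
dimension (i.e. `Ext^m(K, -) = 0` for all sufficiently large `m`), then `K` is acyclic. -/
theorem acyclic_iff_finite_projective_dimension_onePeriodic
    (A : Type u) [Category.{v} A] [Abelian A]
    [HasExt.{w} A] [HasExt.{w'} (OnePeriodic A)]
    (hereditary : ∀ (X Y : A) (p : ℕ), 2 ≤ p → Subsingleton (Abelian.Ext.{w} X Y p))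
    (K : OnePeriodic A) :
    ((∀ i, K.ExactAt i) → ∀ M : OnePeriodic A, Subsingleton (Abelian.Ext.{w'} K M 2)) ∧
    ((∃ n : ℕ, ∀ m : ℕ, n < m → ∀ M : OnePeriodic A,
        Subsingleton (Abelian.Ext.{w'} K M m)) → ∀ i, K.ExactAt i) := by
  obtain ⟨X, d, h, rfl⟩ := OneP.eq_mk K
  constructor
  · intro H M
    have H0 := (OneP.mk_exactAt_iff X d h 0).1 (H 0)
    exact ⟨fun a b => (OneP.forward hereditary X d h H0 M a).trans
      (OneP.forward hereditary X d h H0 M b).symm⟩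
  · rintro ⟨n, H⟩ i
    exact (OneP.mk_exactAt_iff X d h i).2
      (OneP.converse_aux hereditary n X d h (H (n + 2) (by lia)))
end

section
/- Let A be a hereditary abelian category over a field k and X, Y objects of A. In the category C_1(A) of 1-periodic complexes, the Ext group between stalk complexes satisfies Ext^1_{C_1(A)}(C_X, C_Y) ≅ Ext^1_A(X,Y) ⊕ Hom_A(X,Y), where C_X = (X, 0) denotes the complex with zero differential. -/
open CategoryTheory

universe w w' v u

/-- The stalk complex `C_X = (X, 0)` in `C₁(A)`. -/
noncomputable abbrev stalkComplex (A : Type u) [Category.{v} A] [Abelian A] (X : A) :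
    OnePeriodic A :=
  (HomologicalComplex.single A (ComplexShape.up (ZMod 1)) 0).obj X

open Limits Abelian

namespace ExtStalk

section Efface

variable {C : Type u} [Category.{v} C] [Abelian C]

open HomologicalComplex DerivedCategory in
/-- A quasi-isomorphism from a complex concentrated in degrees `≤ i` to a single complex
is an epimorphism in degree `i`. -/
lemma epi_of_quasiIso {P : C} {K : CochainComplex C ℤ} {i : ℤ}
    (π : K ⟶ (single C (ComplexShape.up ℤ) i).obj P) [K.IsStrictlyLE i] [QuasiIsoAt π i] :
    Epi (π.f i) := by
  let e := K.iCyclesIso i (i + 1) (by simp)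
    ((K.isZero_of_isStrictlyLE i (i + 1) (by simp)).eq_of_tgt _ _)
  let α := e.inv ≫ K.homologyπ i ≫ homologyMap π i ≫ (singleObjHomologySelfIso _ _ _).hom
  have : π.f i = α ≫ (singleObjXSelf (ComplexShape.up ℤ) i P).inv := by
    rw [← cancel_epi e.hom]
    dsimp [α, e]
    rw [Category.assoc, Category.assoc, Category.assoc, Iso.hom_inv_id_assoc, iCyclesIso_hom,
      homologyπ_naturality_assoc]
    rw [homologyπ_singleObjHomologySelfIso_hom_assoc,
      ← singleObjCyclesSelfIso_inv_iCycles, Iso.hom_inv_id_assoc, ← cyclesMap_i]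
  rw [this]
  dsimp only [α]
  infer_instance

open HomologicalComplex DerivedCategory in
/-- Morphisms in the derived category from a single complex are effaceable. -/
lemma exists_epi_derived [HasDerivedCategory.{w} C] {X : C} {L : CochainComplex C ℤ} {i : ℤ}
    (φ : Q.obj ((CochainComplex.singleFunctor C i).obj X) ⟶ Q.obj L)
    (n : ℤ) (hn : n < i) [L.IsStrictlyLE n] :
    ∃ (X' : C) (p : X' ⟶ X), Epi p ∧
      Q.map ((CochainComplex.singleFunctor C i).map p) ≫ φ = 0 := by
  obtain ⟨K, _, π, h, g, rfl⟩ := right_fac_of_isStrictlyLE φ i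
  rw [isIso_Q_map_iff_quasiIso] at h
  have hq : QuasiIsoAt (L := (single C (ComplexShape.up ℤ) i).obj X) π i := h.quasiIsoAt i
  have hepi : Epi (π.f i) := epi_of_quasiIso (P := X) π
  let s : (CochainComplex.singleFunctor C i).obj (K.X i) ⟶ K :=
    mkHomFromSingle (𝟙 _) (by
      rintro _ rfl
      apply (K.isZero_of_isStrictlyLE i (i + 1) (by simp)).eq_of_tgt)
  refine ⟨K.X i, π.f i ≫ (singleObjXSelf (ComplexShape.up ℤ) i X).hom, ?_, ?_⟩
  · have : Epi (singleObjXSelf (ComplexShape.up ℤ) i X).hom := inferInstance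
    exact @epi_comp _ _ _ _ _ (π.f i) hepi (singleObjXSelf (ComplexShape.up ℤ) i X).hom this
  · have h₁ : (CochainComplex.singleFunctor C i).map
        (π.f i ≫ (singleObjXSelf (ComplexShape.up ℤ) i X).hom) = s ≫ π := by
      apply HomologicalComplex.from_single_hom_ext
      rw [comp_f]
      simp [s, CochainComplex.singleFunctor, CochainComplex.singleFunctors, 
        HomologicalComplex.single_map_f_self]
    have h₂ : s ≫ g = 0 := by
      apply HomologicalComplex.from_single_hom_ext
      apply (L.isZero_of_isStrictlyLE n i hn).eq_of_tgt
    rw [h₁, Q.map_comp, Category.assoc, IsIso.hom_inv_id_assoc, ← Q.map_comp, h₂, Q.map_zero]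

open DerivedCategory in
/-- `Ext¹` classes are effaceable. -/
lemma exists_epi_ext [HasExt.{w} C] {X Y : C} (e : Ext X Y 1) :
    ∃ (X' : C) (p : X' ⟶ X), Epi p ∧ (Ext.mk₀ p).comp e (zero_add 1) = 0 := by
  let := HasDerivedCategory.standard C
  obtain ⟨X', p, hp, h⟩ := exists_epi_derived
    (L := (CochainComplex.singleFunctor C (-1)).obj Y)
    (e.hom ≫ ((singleFunctors C).shiftIso 1 (-1) 0 (by lia)).hom.app _) (-1) (by lia)
  refine ⟨X', p, hp, ?_⟩
  apply Ext.ext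
  rw [Ext.comp_hom, Ext.mk₀_hom, Ext.zero_hom, ShiftedHom.mk₀_comp]
  rw [← cancel_mono (((singleFunctors C).shiftIso 1 (-1) 0 (by lia)).hom.app _),
    Limits.zero_comp, Category.assoc]
  exact h

/-- Every `Ext¹` class is the pushforward of the class of a short exact sequence. -/
lemma exists_extClass [HasExt.{w} C] {X Y : C} (e : Ext X Y 1) :
    ∃ (K E : C) (i : K ⟶ E) (p : E ⟶ X) (z : i ≫ p = 0)
      (hS : (ShortComplex.mk i p z).ShortExact) (f : K ⟶ Y),
      e = hS.extClass.comp (Ext.mk₀ f) (add_zero 1) := by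
  obtain ⟨X', p, hp, h⟩ := exists_epi_ext e
  have hS : (ShortComplex.mk (kernel.ι p) p (kernel.condition p)).ShortExact :=
    { exact := ShortComplex.exact_of_f_is_kernel _ (kernelIsKernel p) }
  obtain ⟨x, hx⟩ := Ext.contravariant_sequence_exact₃ hS Y e h (n₀ := 0) rfl
  obtain ⟨f, rfl⟩ := (Ext.mk₀_bijective _ _).2 x
  exact ⟨_, _, _, _, _, hS, f, hx.symm⟩

/-- Image of a pushforward of the class of a short exact sequence. -/
lemma map_extClass_comp {C D : Type*} [Category* C] [Abelian C] [Category* D] [Abelian D]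
    [HasExt.{w} C] [HasExt.{w'} D]
    (F : C ⥤ D) [F.Additive] [PreservesFiniteLimits F] [PreservesFiniteColimits F]
    {S : ShortComplex C} (hS : S.ShortExact) {Y : C} (f : S.X₁ ⟶ Y) :
    (hS.extClass.comp (Ext.mk₀ f) (add_zero 1)).mapExactFunctor F =
      (hS.map_of_exact F).extClass.comp (Ext.mk₀ (F.map f)) (add_zero 1) := by
  refine (Ext.mapExactFunctor_comp F _ _ _).trans ?_
  rw [Ext.mapExactFunctor_mk₀, Ext.mapExactFunctor_extClass]
  rfl

end Efface

section Main

variable (A : Type u) [Category.{v} A] [Abelian A]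

/-- Strict version of the stalk complex functor. -/

noncomputable abbrev stalk : A ⥤ OnePeriodic A where
  obj X := { X := fun _ => X, d := fun _ _ => 0 }
  map f := { f := fun _ => f }

instance : (stalk A).Additive where

instance : PreservesFiniteLimits (stalk A) :=
  ⟨fun J _ _ => HomologicalComplex.preservesLimitsOfShape_of_eval _ (fun _ =>
    inferInstanceAs <| PreservesLimitsOfShape J (𝟭 A))⟩

instance : PreservesFiniteColimits (stalk A) :=
  ⟨fun J _ _ => HomologicalComplex.preservesColimitsOfShape_of_eval _ (fun _ =>
    inferInstanceAs <| PreservesColimitsOfShape J (𝟭 A))⟩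

variable {A}

/-- The stalk complex is the strict stalk complex. -/
noncomputable def stalkIso (X : A) : stalkComplex A X ≅ (stalk A).obj X :=
  HomologicalComplex.Hom.isoOfComponents
    (fun i => HomologicalComplex.singleObjXIsoOfEq _ 0 X i (Subsingleton.elim _ _))
    (by intros; simp)

/-- The complex `(Y ⊕ Y, d)` with `d (a, b) = (b, 0)`. -/

noncomputable abbrev cone (Y : A) : OnePeriodic A where
  X _ := Y ⊞ Y
  d _ _ := biprod.snd ≫ biprod.inl
  shape i j h := (h (Subsingleton.elim (α := Fin 1) _ _)).elim

/-- The inclusion of the stalk. -/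

noncomputable abbrev coneι (Y : A) : (stalk A).obj Y ⟶ cone Y where
  f _ := biprod.inl

/-- The projection to the stalk. -/

noncomputable abbrev coneπ (Y : A) : cone Y ⟶ (stalk A).obj Y where
  f _ := biprod.snd

lemma coneι_π (Y : A) : coneι Y ≫ coneπ Y = 0 := by
  ext i
  simp

/-- The short complex `C_Y → (Y ⊕ Y, d) → C_Y`. -/
noncomputable abbrev coneSeq (Y : A) : ShortComplex (OnePeriodic A) :=
  ShortComplex.mk _ _ (coneι_π Y)

/-- Degreewise splitting. -/
noncomputable abbrev coneSplitting (Y : A) (i : ZMod 1) :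
    ((coneSeq Y).map (HomologicalComplex.eval A _ i)).Splitting :=
  ShortComplex.Splitting.mk (r := (biprod.fst : Y ⊞ Y ⟶ Y)) (s := (biprod.inr : Y ⟶ Y ⊞ Y))
    biprod.inl_fst biprod.inr_snd biprod.total

lemma coneSeq_shortExact (Y : A) : (coneSeq Y).ShortExact :=
  HomologicalComplex.shortExact_of_degreewise_shortExact _
    (fun i => (coneSplitting Y i).shortExact)

variable [HasExt.{w'} (OnePeriodic A)]

/-- Forget the differential. -/
noncomputable abbrev ev (A : Type u) [Category.{v} A] [Abelian A] : OnePeriodic A ⥤ A :=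
  HomologicalComplex.eval A (ComplexShape.up (ZMod 1)) 0

lemma cone_injective {X Y : A} (φ : X ⟶ Y)
    (h : (Ext.mk₀ ((stalk A).map φ)).comp (coneSeq_shortExact Y).extClass (zero_add 1) = 0) :
    φ = 0 := by
  obtain ⟨x, hx⟩ := Ext.covariant_sequence_exact₃ _ (coneSeq_shortExact Y) _ _ h
  obtain ⟨f, rfl⟩ := (Ext.mk₀_bijective _ _).2 x
  rw [Ext.mk₀_comp_mk₀] at hx
  have hf := congr_arg (fun t => HomologicalComplex.Hom.f t 0) ((Ext.mk₀_bijective _ _).1 hx)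
  have hc := f.comm 0 0
  dsimp at hf hc
  rw [zero_comp] at hc
  rw [← hf]
  simpa using hc =≫ biprod.fst

/-- `Hom(X, Y) → Ext¹(C_X, C_Y)`. -/
noncomputable def coMap (X Y : A) :
    (X ⟶ Y) →+ Ext.{w'} ((stalk A).obj X) ((stalk A).obj Y) 1 :=
  AddMonoidHom.mk'
    (fun φ => (Ext.mk₀ ((stalk A).map φ)).comp (coneSeq_shortExact Y).extClass (zero_add 1))
    (fun a b => by
      have : (stalk A).map (a + b) = (stalk A).map a + (stalk A).map b := rfl
      rw [this, Ext.mk₀_add, Ext.add_comp])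

variable [HasExt.{w} A]

lemma ev_stalk {X Y : A} (e : Ext.{w} X Y 1) :
    Ext.mapExactFunctor.{w', w} (ev A) (e.mapExactFunctor (stalk A)) = e := by
  obtain ⟨K, E, i, p, z, hS, f, rfl⟩ := exists_extClass e
  exact (congrArg (fun t => Ext.mapExactFunctor.{w', w} (ev A) t)
    (map_extClass_comp.{w, w'} (stalk A) hS f)).trans
      (map_extClass_comp.{w', w} (ev A) (hS.map_of_exact (stalk A)) ((stalk A).map f))

lemma ev_cone (Y : A) :
    Ext.mapExactFunctor.{w', w} (ev A) (coneSeq_shortExact Y).extClass = 0 := by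
  rw [Ext.mapExactFunctor_extClass]
  have h := (((coneSeq_shortExact Y).map_of_exact (ev A)).comp_extClass)
  have hs := (coneSplitting Y 0).s_g
  rw [← Ext.mk₀_id_comp (ShortComplex.ShortExact.extClass _), ← hs, ← Ext.mk₀_comp_mk₀,
    Ext.comp_assoc_of_second_deg_zero]
  erw [h]
  exact Ext.comp_zero _ _ _ _ _

lemma cone_surjective {X Y : A} (e : Ext.{w'} ((stalk A).obj X) ((stalk A).obj Y) 1)
    (he : Ext.mapExactFunctor.{w', w} (ev A) e = 0) :
    ∃ φ : X ⟶ Y, (Ext.mk₀ ((stalk A).map φ)).comp (coneSeq_shortExact Y).extClass (zero_add 1)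
      = e := by
  obtain ⟨K, E, i, p, z, hS, f, rfl⟩ := exists_extClass e
  rw [Ext.mapExactFunctor_comp, Ext.mapExactFunctor_mk₀, Ext.mapExactFunctor_extClass] at he
  obtain ⟨x, hx⟩ := Ext.contravariant_sequence_exact₁ (hS.map_of_exact (ev A)) _ _ _ he
  obtain ⟨h, rfl⟩ := (Ext.mk₀_bijective _ _).2 x
  rw [Ext.mk₀_comp_mk₀] at hx
  replace hx := (Ext.mk₀_bijective _ _).1 hx
  -- a family version of `h`
  obtain ⟨t, ht⟩ : ∃ t : ∀ j, E.X j ⟶ Y, ∀ j, i.f j ≫ t j = f.f j :=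
    ⟨fun j => (E.XIsoOfEq (Subsingleton.elim (α := Fin 1) j 0)).hom ≫ h, fun j => by
      obtain rfl : j = 0 := Subsingleton.elim (α := Fin 1) _ _
      simp only [HomologicalComplex.XIsoOfEq_rfl, Iso.refl_hom]
      exact (congrArg (fun t => i.f 0 ≫ t) (Category.id_comp h)).trans hx⟩
  have htd : ∀ a b c, E.d a b ≫ t b = E.d a c ≫ t c := by
    intro a b c
    obtain rfl : b = c := Subsingleton.elim (α := Fin 1) _ _
    rfl
  let α : E ⟶ cone Y :=
    { f := fun j => biprod.lift (t j) (E.d j 0 ≫ t 0)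
      comm' := by
        intro a b _
        dsimp
        ext
        · simp [htd a b 0]
        · simp }
  have hi : i ≫ α = f ≫ coneι Y := by
    ext j
    · simp [α, ht]
    · have := f.comm j 0
      dsimp at this
      simp [α, ht, ← this]
  have hS0 := hS.map_of_exact (ev A)
  have hz : i.f 0 ≫ (E.d 0 0 ≫ t 0) = 0 := by
    have := f.comm 0 0
    dsimp at this
    rw [i.comm_assoc, ht, ← this, comp_zero]
  have := hS0.epi_g
  obtain ⟨φ, hφ⟩ : ∃ φ : X ⟶ Y, p.f 0 ≫ φ = E.d 0 0 ≫ t 0 :=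
    ⟨hS0.exact.desc _ hz, hS0.exact.g_desc _ hz⟩
  have hp : α ≫ coneπ Y = p ≫ (stalk A).map φ := by
    ext j
    obtain rfl : j = 0 := Subsingleton.elim (α := Fin 1) _ _
    dsimp [α]
    simp [hφ]
  let m : ShortComplex.mk i p z ⟶ coneSeq Y := ⟨f, α, (stalk A).map φ, hi.symm, hp⟩
  exact ⟨φ, (ShortComplex.ShortExact.extClass_naturality hS (coneSeq_shortExact Y) m).symm⟩

/-- `Ext¹(C_X, C_Y) → Ext¹(X, Y)`. -/
noncomputable def evMap (X Y : A) :
    Ext.{w'} ((stalk A).obj X) ((stalk A).obj Y) 1 →+ Ext.{w} X Y 1 :=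
  (ev A).mapExtAddHom _ _ 1

/-- `Ext¹(X, Y) → Ext¹(C_X, C_Y)`. -/
noncomputable def stMap (X Y : A) :
    Ext.{w} X Y 1 →+ Ext.{w'} ((stalk A).obj X) ((stalk A).obj Y) 1 :=
  (stalk A).mapExtAddHom _ _ 1

lemma evMap_coMap {X Y : A} (φ : X ⟶ Y) :
    evMap.{w, w'} X Y (coMap.{w'} X Y φ) = 0 := by
  refine (Ext.mapExactFunctor_comp (ev A) (Ext.mk₀ ((stalk A).map φ))
    (coneSeq_shortExact Y).extClass (zero_add 1)).trans ?_
  rw [ev_cone]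
  exact Ext.comp_zero _ _ _ _ _

lemma bijective_of_split {G H K : Type*} [AddCommGroup G] [AddCommGroup H] [AddCommGroup K]
    (p : G →+ H) (s : H →+ G) (c : K →+ G) (hps : ∀ x, p (s x) = x) (hpc : ∀ x, p (c x) = 0)
    (hc : ∀ x, c x = 0 → x = 0) (hex : ∀ g, p g = 0 → ∃ x, c x = g) :
    Function.Bijective (s.coprod c) := by
  constructor
  · rw [injective_iff_map_eq_zero]
    rintro ⟨a, b⟩ h
    rw [AddMonoidHom.coprod_apply] at h
    have ha : a = 0 := by
      have := congrArg p h
      simpa [hps, hpc] using this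
    subst ha
    have hb : b = 0 := hc b (by simpa using h)
    rw [hb]
    rfl
  · intro g
    obtain ⟨x, hx⟩ := hex (g - s (p g)) (by rw [map_sub, hps, sub_self])
    exact ⟨(p g, x), by rw [AddMonoidHom.coprod_apply, hx]; abel⟩

lemma comparison_bijective (X Y : A) :
    Function.Bijective ((stMap.{w, w'} X Y).coprod (coMap.{w'} X Y)) :=
  bijective_of_split (evMap.{w, w'} X Y) _ _ (fun e => ev_stalk e) (fun φ => evMap_coMap φ)
    (fun φ h => cone_injective.{w'} φ h) (fun e h => cone_surjective.{w, w'} e h)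

/-- `Ext` is invariant under isomorphism. -/
noncomputable def extCongr {C : Type u} [Category.{v} C] [Abelian C] [HasExt.{w} C]
    {X X' Y Y' : C} (a : X ≅ X') (b : Y ≅ Y') (n : ℕ) : Ext X Y n ≃+ Ext X' Y' n where
  toFun e := (Ext.mk₀ a.inv).comp (e.comp (Ext.mk₀ b.hom) (add_zero n)) (zero_add n)
  invFun e := (Ext.mk₀ a.hom).comp (e.comp (Ext.mk₀ b.inv) (add_zero n)) (zero_add n)
  left_inv e := by simp
  right_inv e := by simp
  map_add' := by simp

end Main

end ExtStalk

/-- Let `A` be a hereditary abelian category, linear over a field `k`, and `X, Y ∈ A`.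
Then `Ext¹_{C₁(A)}(C_X, C_Y) ≅ Ext¹_A(X, Y) ⊕ Hom_A(X, Y)` for the stalk complexes
`C_X = (X, 0)`, `C_Y = (Y, 0)`. -/
theorem ext_one_stalkComplex
    (k : Type*) [Field k]
    (A : Type u) [Category.{v} A] [Abelian A] [Linear k A]
    [HasExt.{w} A] [HasExt.{w'} (OnePeriodic A)]
    (hereditary : ∀ (X Y : A) (p : ℕ), 2 ≤ p → Subsingleton (Abelian.Ext.{w} X Y p))
    (X Y : A) :
    Nonempty (Abelian.Ext.{w'} (stalkComplex A X) (stalkComplex A Y) 1 ≃+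
      (Abelian.Ext.{w} X Y 1) × (X ⟶ Y)) := by
  exact ⟨(ExtStalk.extCongr (ExtStalk.stalkIso X) (ExtStalk.stalkIso Y) 1).trans
    (AddEquiv.ofBijective _ (ExtStalk.comparison_bijective.{w, w'} X Y)).symm⟩
end
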